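/- Define f₁ : ℝ → ℝ by f₁(x) = x·sin(ln x) + x·cos(ln x) + 5x for x > 0 and f₁(x) = 6x for x ≤ 0, and f₂ : ℝ → ℝ by f₂(x) = 3|x|. Then for all λ₁, λ₂ ≥ 0 and every u ∈ ℝ with 0 ∈ ∂(λ₁ f₁ + λ₂ f₂)(u), the point u is a global minimum of λ₁ f₁ + λ₂ f₂ over ℝ, i.e., λ₁ f₁(u) + λ₂ f₂(u) ≤ λ₁ f₁(x) + λ₂ f₂(x) for all x ∈ ℝ. -/

import Mathlib

open Filter Set

/-- Clarke's generalized directional derivative of `f : ℝ → ℝ` at `u` in direction `d`. -/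
noncomputable def clarkeDeriv1 (f : ℝ → ℝ) (u d : ℝ) : ℝ :=
  Filter.limsup (fun p : ℝ × ℝ => (f (p.1 + p.2 * d) - f p.1) / p.2)
    ((nhds u) ×ˢ (nhdsWithin 0 (Set.Ioi (0:ℝ))))

/-- Clarke's subdifferential of `f : ℝ → ℝ` at `u`. -/
noncomputable def clarkeSubdiff1 (f : ℝ → ℝ) (u : ℝ) : Set ℝ :=
  {ξ | ∀ d, ξ * d ≤ clarkeDeriv1 f u d}

/-- The example function `f₁`. -/
noncomputable def f₁ : ℝ → ℝ := fun x =>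
  if 0 < x then x * Real.sin (Real.log x) + x * Real.cos (Real.log x) + 5 * x else 6 * x

/-- The example function `f₂`. -/
noncomputable def f₂ : ℝ → ℝ := fun x => 3 * |x|

theorem clarkeDeriv1_le {f : ℝ → ℝ} {u d K c : ℝ}
    (h : ∀ᶠ p : ℝ × ℝ in (nhds u) ×ˢ (nhdsWithin 0 (Set.Ioi (0:ℝ))),
      K * p.2 ≤ f (p.1 + p.2 * d) - f p.1 ∧ f (p.1 + p.2 * d) - f p.1 ≤ c * p.2) :
    clarkeDeriv1 f u d ≤ c := by
  have hpos : ∀ᶠ p : ℝ × ℝ in (nhds u) ×ˢ (nhdsWithin 0 (Set.Ioi (0:ℝ))), 0 < p.2 :=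
    tendsto_snd.eventually self_mem_nhdsWithin
  refine limsup_le_of_le (IsBoundedUnder.isCoboundedUnder_le ⟨K, ?_⟩) ?_
  · rw [eventually_map]
    filter_upwards [h, hpos] with p hp hp0
    exact (le_div_iff₀ hp0).2 hp.1
  · filter_upwards [h, hpos] with p hp hp0
    exact (div_le_iff₀ hp0).2 hp.2

theorem f₁_of_pos {x : ℝ} (hx : 0 < x) :
    f₁ x = x * Real.sin (Real.log x) + x * Real.cos (Real.log x) + 5 * x := if_pos hx

theorem f₁_of_nonpos {x : ℝ} (hx : x ≤ 0) : f₁ x = 6 * x := if_neg hx.not_gt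

theorem hasDerivAt_f₁ {x : ℝ} (hx : 0 < x) :
    HasDerivAt f₁ (2 * Real.cos (Real.log x) + 5) x := by
  have hl := Real.hasDerivAt_log hx.ne'
  have h := (((hasDerivAt_id x).mul hl.sin).add ((hasDerivAt_id x).mul hl.cos)).add
    ((hasDerivAt_id x).const_mul 5)
  refine (h.congr_of_eventuallyEq ?_).congr_deriv ?_
  · filter_upwards [lt_mem_nhds hx] with y hy
    simp [f₁_of_pos hy]
  · simp only [id]
    field_simp
    ring

theorem f₁_slope {x y : ℝ} (hxy : x ≤ y) :
    3 * (y - x) ≤ f₁ y - f₁ x ∧ f₁ y - f₁ x ≤ 7 * (y - x) := by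
  rcases le_or_gt y 0 with hy | hy
  · rw [f₁_of_nonpos hy, f₁_of_nonpos (hxy.trans hy)]
    constructor <;> linarith
  rcases le_or_gt x 0 with hx | hx
  · rw [f₁_of_pos hy, f₁_of_nonpos hx]
    have hs := Real.sin_sq_add_cos_sq (Real.log y)
    set s := Real.sin (Real.log y)
    set c := Real.cos (Real.log y)
    have h1 : -2 ≤ s + c := by nlinarith [sq_nonneg (s - c)]
    have h2 : s + c ≤ 2 := by nlinarith [sq_nonneg (s - c)]
    constructor <;> nlinarith
  · have hd : DifferentiableOn ℝ f₁ (Ioi 0) := fun z hz =>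
      (hasDerivAt_f₁ hz).differentiableAt.differentiableWithinAt
    constructor
    · refine (convex_Ioi (0:ℝ)).mul_sub_le_image_sub_of_le_deriv hd.continuousOn
        (hd.mono interior_subset) (fun z hz => ?_) x hx y hy hxy
      rw [interior_Ioi] at hz
      rw [(hasDerivAt_f₁ hz).deriv]
      linarith [Real.neg_one_le_cos (Real.log z)]
    · refine (convex_Ioi (0:ℝ)).image_sub_le_mul_sub_of_deriv_le hd.continuousOn
        (hd.mono interior_subset) (fun z hz => ?_) x hx y hy hxy
      rw [interior_Ioi] at hz
      rw [(hasDerivAt_f₁ hz).deriv]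
      linarith [Real.cos_le_one (Real.log z)]

theorem f₂_of_nonneg {x : ℝ} (hx : 0 ≤ x) : f₂ x = 3 * x := by simp [f₂, abs_of_nonneg hx]

theorem f₂_of_nonpos {x : ℝ} (hx : x ≤ 0) : f₂ x = -3 * x := by simp [f₂, abs_of_nonpos hx]

section Combination

variable {l₁ l₂ : ℝ}

theorem combination_of_nonpos {x : ℝ} (hx : x ≤ 0) :
    l₁ * f₁ x + l₂ * f₂ x = (6 * l₁ - 3 * l₂) * x := by
  rw [f₁_of_nonpos hx, f₂_of_nonpos hx]
  ring

theorem combination_slope_of_nonneg (hl₁ : 0 ≤ l₁) {x y : ℝ} (hx : 0 ≤ x) (hxy : x ≤ y) :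
    (3 * l₁ + 3 * l₂) * (y - x) ≤ (l₁ * f₁ y + l₂ * f₂ y) - (l₁ * f₁ x + l₂ * f₂ x) := by
  rw [f₂_of_nonneg hx, f₂_of_nonneg (hx.trans hxy)]
  linarith [mul_le_mul_of_nonneg_left (f₁_slope hxy).1 hl₁]

theorem combination_slope_le (hl₁ : 0 ≤ l₁) (hl₂ : 0 ≤ l₂) {x y : ℝ} (hxy : x ≤ y) :
    (l₁ * f₁ y + l₂ * f₂ y) - (l₁ * f₁ x + l₂ * f₂ x) ≤ (7 * l₁ + 3 * l₂) * (y - x) := by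
  have h : f₂ y - f₂ x ≤ 3 * (y - x) := by
    have := abs_sub_abs_le_abs_sub y x
    rw [abs_of_nonneg (sub_nonneg.2 hxy)] at this
    simp only [f₂]
    linarith
  linarith [mul_le_mul_of_nonneg_left (f₁_slope hxy).2 hl₁, mul_le_mul_of_nonneg_left h hl₂]

theorem le_combination_slope (hl₁ : 0 ≤ l₁) {c x y : ℝ} (hc : c ≤ 6 * l₁ - 3 * l₂)
    (hc' : c ≤ 3 * l₁ + 3 * l₂) (hxy : x ≤ y) :
    c * (y - x) ≤ (l₁ * f₁ y + l₂ * f₂ y) - (l₁ * f₁ x + l₂ * f₂ x) := by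
  rcases le_total y 0 with hy | hy
  · rw [combination_of_nonpos hy, combination_of_nonpos (hxy.trans hy), ← mul_sub]
    exact mul_le_mul_of_nonneg_right hc (sub_nonneg.2 hxy)
  rcases le_total x 0 with hx | hx
  · have h := combination_slope_of_nonneg (l₂ := l₂) hl₁ le_rfl hy
    rw [combination_of_nonpos le_rfl] at h
    rw [combination_of_nonpos hx]
    nlinarith
  · exact (mul_le_mul_of_nonneg_right hc' (sub_nonneg.2 hxy)).trans
      (combination_slope_of_nonneg hl₁ hx hxy)

theorem combination_nonneg (hl₁ : 0 ≤ l₁) (hl₂ : 0 ≤ l₂) (h : 2 * l₁ ≤ l₂) (x : ℝ) :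
    0 ≤ l₁ * f₁ x + l₂ * f₂ x := by
  rcases le_total x 0 with hx | hx
  · rw [combination_of_nonpos hx]
    nlinarith
  · have h := combination_slope_of_nonneg (l₂ := l₂) hl₁ le_rfl hx
    rw [combination_of_nonpos le_rfl] at h
    nlinarith

/-- A positive lower bound `c` on the slopes near `u` excludes Clarke stationarity at `u`. -/
theorem nonpos_of_stationary_of_le_slope (hl₁ : 0 ≤ l₁) (hl₂ : 0 ≤ l₂) {u c : ℝ}
    (hu : (0 : ℝ) ∈ clarkeSubdiff1 (fun x => l₁ * f₁ x + l₂ * f₂ x) u) {s : Set ℝ}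
    (hs : s ∈ nhds u)
    (h : ∀ x ∈ s, ∀ y ∈ s, x ≤ y →
      c * (y - x) ≤ (l₁ * f₁ y + l₂ * f₂ y) - (l₁ * f₁ x + l₂ * f₂ x)) : c ≤ 0 := by
  have hle : clarkeDeriv1 (fun x => l₁ * f₁ x + l₂ * f₂ x) u (-1) ≤ -c := by
    refine clarkeDeriv1_le (K := -(7 * l₁ + 3 * l₂)) ?_
    have hsnd : Tendsto Prod.snd ((nhds u) ×ˢ (nhdsWithin 0 (Ioi (0:ℝ)))) (nhds 0) :=
      tendsto_snd.mono_right nhdsWithin_le_nhds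
    have hlim : Tendsto (fun p : ℝ × ℝ => p.1 + p.2 * (-1))
        ((nhds u) ×ˢ (nhdsWithin 0 (Ioi (0:ℝ)))) (nhds u) := by
      simpa using tendsto_fst.add (hsnd.mul_const (-1))
    filter_upwards [tendsto_fst.eventually hs, hlim.eventually hs,
      tendsto_snd.eventually self_mem_nhdsWithin] with p hp hp' hp0
    have hp0 : 0 < p.2 := hp0
    have hxy : p.1 + p.2 * (-1) ≤ p.1 := by linarith
    constructor
    · linarith [combination_slope_le hl₁ hl₂ hxy]
    · linarith [h _ hp' _ hp hxy]
  linarith [hu (-1)]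

theorem nonneg_of_stationary_of_neg {u : ℝ} (hu0 : u < 0)
    (hu : (0 : ℝ) ∈ clarkeSubdiff1 (fun x => l₁ * f₁ x + l₂ * f₂ x) u) :
    0 ≤ 6 * l₁ - 3 * l₂ := by
  have hle : clarkeDeriv1 (fun x => l₁ * f₁ x + l₂ * f₂ x) u 1 ≤ 6 * l₁ - 3 * l₂ := by
    refine clarkeDeriv1_le (K := 6 * l₁ - 3 * l₂) ?_
    have hsnd : Tendsto Prod.snd ((nhds u) ×ˢ (nhdsWithin 0 (Ioi (0:ℝ)))) (nhds 0) :=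
      tendsto_snd.mono_right nhdsWithin_le_nhds
    have hlim : Tendsto (fun p : ℝ × ℝ => p.1 + p.2 * 1)
        ((nhds u) ×ˢ (nhdsWithin 0 (Ioi (0:ℝ)))) (nhds u) := by
      simpa using tendsto_fst.add (hsnd.mul_const 1)
    filter_upwards [tendsto_fst.eventually (Iio_mem_nhds hu0),
      hlim.eventually (Iio_mem_nhds hu0)] with p hp hp'
    rw [combination_of_nonpos (le_of_lt hp), combination_of_nonpos (le_of_lt hp')]
    constructor <;> linarith
  linarith [hu 1]

end Combination

theorem stmt7 (l₁ l₂ : ℝ) (hl₁ : 0 ≤ l₁) (hl₂ : 0 ≤ l₂) (u : ℝ)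
    (hu : (0 : ℝ) ∈ clarkeSubdiff1 (fun x => l₁ * f₁ x + l₂ * f₂ x) u) :
    ∀ x : ℝ, l₁ * f₁ u + l₂ * f₂ u ≤ l₁ * f₁ x + l₂ * f₂ x := by
  intro x
  have hmin : min (6 * l₁ - 3 * l₂) (3 * l₁ + 3 * l₂) ≤ 0 :=
    nonpos_of_stationary_of_le_slope hl₁ hl₂ hu univ_mem fun _ _ _ _ hxy =>
      le_combination_slope hl₁ (min_le_left _ _) (min_le_right _ _) hxy
  have h : 2 * l₁ ≤ l₂ := by
    rcases min_le_iff.1 hmin with h | h <;> linarith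
  refine le_trans (le_of_eq ?_) (combination_nonneg hl₁ hl₂ h x)
  rcases le_or_gt u 0 with hu0 | hu0
  · rw [combination_of_nonpos hu0]
    rcases hu0.eq_or_lt with rfl | hneg
    · exact mul_zero _
    · have := nonneg_of_stationary_of_neg hneg hu
      rw [show 6 * l₁ - 3 * l₂ = 0 by linarith, zero_mul]
  · have hc : 3 * l₁ + 3 * l₂ ≤ 0 :=
      nonpos_of_stationary_of_le_slope hl₁ hl₂ hu (Ioi_mem_nhds hu0) fun _ hy _ _ hyz =>
        combination_slope_of_nonneg hl₁ (le_of_lt hy) hyz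
    rw [show l₁ = 0 by linarith, show l₂ = 0 by linarith]
    simp
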